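/- arXiv:1507.01115 — 3 statements merged into one kernel-verified Lean document; each statement's English description precedes it below -/
import Mathlib

section
/- Let P = (P^{ij}) be an antisymmetric n×n matrix of entire functions on ℂⁿ defining a holomorphic Poisson structure (i.e. satisfying the Jacobi identity Σ_l (P^{li} ∂P^{jk}/∂z^l + P^{lj} ∂P^{ki}/∂z^l + P^{lk} ∂P^{ij}/∂z^l) = 0 for all i,j,k). Write z^k = x^k + i·x^{n+k}, and define real antisymmetric 2n×2n matrices P_ℝ and P_𝕀 by P_ℝ^{ij} = (1/4)Re P^{ij}, P_ℝ^{i,n+j} = (1/4)Im P^{ij}, P_ℝ^{n+i,j} = −(1/4)Im P^{ji}, P_ℝ^{n+i,n+j} = −(1/4)Re P^{ij}, and P_𝕀^{ij} = (1/4)Im P^{ij}, P_𝕀^{i,n+j} = −(1/4)Re P^{ij}, P_𝕀^{n+i,j} = (1/4)Re P^{ji}, P_𝕀^{n+i,n+j} = −(1/4)Im P^{ij}. For a smooth real function u, let Z^ℝ_u = (Σ_a P_ℝ^{ab} ∂u/∂x^a)_b and Z^𝕀_u = (Σ_a P_𝕀^{ab} ∂u/∂x^a)_b be its real Hamiltonian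 vector fields. Let f and α be nowhere-vanishing entire functions on ℂⁿ. Then α is a holomorphic last multiplier for the holomorphic Hamiltonian vector field Z_{log f} := (1/f)·Z_f if and only if |α|² is a real last multiplier (with respect to Lebesgue volume) for BOTH real vector fields (1/|f|²)·Z^ℝ_{|f|²} and (1/|f|²)·Z^𝕀_{|f|²}. -/
open scoped BigOperators

variable {n : ℕ}

/-- Partial derivative ∂f/∂z^i of a function on ℂⁿ. -/
noncomputable def pd (f : (Fin n → ℂ) → ℂ) (i : Fin n) (z : Fin n → ℂ) : ℂ :=
  fderiv ℂ f z (Pi.single i 1)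

/-- Holomorphic divergence div Z = Σ_k ∂Z^k/∂z^k. -/
noncomputable def hdiv (Z : (Fin n → ℂ) → (Fin n → ℂ)) (z : Fin n → ℂ) : ℂ :=
  ∑ k, pd (fun w => Z w k) k z

/-- Holomorphic last multiplier: Z(α) + α · div Z = 0. -/
def IsHLM (Z : (Fin n → ℂ) → (Fin n → ℂ)) (α : (Fin n → ℂ) → ℂ) : Prop :=
  ∀ z, (∑ k, Z z k * pd α k z) + α z * hdiv Z z = 0

/-- Real divergence: trace over ℝ of the real Fréchet derivative. -/
noncomputable def rdiv (X : (Fin n → ℂ) → (Fin n → ℂ)) (z : Fin n → ℂ) : ℝ :=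
  LinearMap.trace ℝ (Fin n → ℂ) (fderiv ℝ X z : (Fin n → ℂ) →ₗ[ℝ] (Fin n → ℂ))

/-- Real last multiplier: (Dᵣu)(X) + u · divᵣ X = 0. -/
def IsRLM (X : (Fin n → ℂ) → (Fin n → ℂ)) (u : (Fin n → ℂ) → ℝ) : Prop :=
  ∀ z, fderiv ℝ u z (X z) + u z * rdiv X z = 0

/-- ∂u/∂x^i for real-valued u. -/
noncomputable def px (u : (Fin n → ℂ) → ℝ) (i : Fin n) (z : Fin n → ℂ) : ℝ :=
  fderiv ℝ u z (Pi.single i 1)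

/-- ∂u/∂x^{n+i} for real-valued u. -/
noncomputable def py (u : (Fin n → ℂ) → ℝ) (i : Fin n) (z : Fin n → ℂ) : ℝ :=
  fderiv ℝ u z (Pi.single i Complex.I)

/-- Lie bracket of two vector fields. -/
noncomputable def lie (Z W : (Fin n → ℂ) → (Fin n → ℂ)) (z : Fin n → ℂ) : Fin n → ℂ :=
  fderiv ℂ W z (Z z) - fderiv ℂ Z z (W z)

/-- Holomorphic Laplacian Δu = Σ_i ∂²u/∂(z^i)². -/
noncomputable def lap (f : (Fin n → ℂ) → ℂ) (z : Fin n → ℂ) : ℂ :=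
  ∑ i, pd (pd f i) i z

/-- The real trace of a complex-linear endomorphism of `ℂⁿ` is twice the real part of its
complex trace. -/
theorem trace_restrictScalars_pi (L : (Fin n → ℂ) →L[ℂ] (Fin n → ℂ)) :
    LinearMap.trace ℝ (Fin n → ℂ)
        (L.restrictScalars ℝ : (Fin n → ℂ) →ₗ[ℝ] (Fin n → ℂ)) =
      2 * (∑ k, L (Pi.single k 1) k).re := by
  rw [LinearMap.trace_eq_matrix_trace ℝ
    (Complex.basisOneI.smulTower (Pi.basisFun ℂ (Fin n))), Matrix.trace, Fintype.sum_prod_type]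
  simp [LinearMap.toMatrix_apply, two_mul, Module.Basis.smulTower_repr]

/-- The real divergence of a holomorphic field is twice the real part of its divergence. -/
theorem rdiv_eq_two_mul_re_hdiv {Z : (Fin n → ℂ) → (Fin n → ℂ)} {z : Fin n → ℂ}
    (hZ : DifferentiableAt ℂ Z z) : rdiv Z z = 2 * (hdiv Z z).re := by
  unfold rdiv hdiv pd
  rw [hZ.fderiv_restrictScalars ℝ, trace_restrictScalars_pi]
  congr 3 with k
  rw [fderiv_apply hZ]
  rfl

/-- Real derivative of `|g|²` for holomorphic `g`. -/
theorem fderiv_normSq_comp {g : (Fin n → ℂ) → ℂ} {z : Fin n → ℂ}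
    (hg : DifferentiableAt ℂ g z) (v : Fin n → ℂ) :
    fderiv ℝ (fun w => Complex.normSq (g w)) z v =
      2 * (starRingEnd ℂ (g z) * fderiv ℂ g z v).re := by
  have h := (hg.hasFDerivAt.restrictScalars ℝ).norm_sq
  simp only [← Complex.normSq_eq_norm_sq] at h
  rw [h.fderiv]
  simp [Complex.inner]
  ring

/-- The derivative along a vector `v` in coordinates. -/
theorem sum_mul_pd (α : (Fin n → ℂ) → ℂ) (z v : Fin n → ℂ) :
    ∑ k, v k * pd α k z = fderiv ℂ α z v := by
  conv_rhs => rw [← Finset.univ_sum_single v, map_sum]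
  refine Finset.sum_congr rfl fun k _ => ?_
  rw [pd, ← smul_eq_mul, ← map_smul, ← Pi.single_smul]
  simp

theorem hdiv_const_smul (c : ℂ) {Z : (Fin n → ℂ) → (Fin n → ℂ)} {z : Fin n → ℂ}
    (hZ : DifferentiableAt ℂ Z z) : hdiv (c • Z) z = c * hdiv Z z := by
  unfold hdiv pd
  rw [Finset.mul_sum]
  refine Finset.sum_congr rfl fun k _ => ?_
  have hk : DifferentiableAt ℂ (fun w => Z w k) z := differentiableAt_pi.1 hZ k
  have := fderiv_const_smul hk c
  exact congrArg (fun L => L (Pi.single k 1)) this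

/-- The real last multiplier condition on `|α|²` for a constant multiple of a holomorphic field,
in terms of the holomorphic one. -/
theorem isRLM_const_smul_normSq_iff (c : ℂ) {Z : (Fin n → ℂ) → (Fin n → ℂ)}
    (hZ : Differentiable ℂ Z) {α : (Fin n → ℂ) → ℂ} (hα : Differentiable ℂ α) :
    IsRLM (c • Z) (fun z => Complex.normSq (α z)) ↔
      ∀ z, (c * (starRingEnd ℂ (α z) *
        ((∑ k, Z z k * pd α k z) + α z * hdiv Z z))).re = 0 := by
  refine forall_congr' fun z => ?_
  rw [fderiv_normSq_comp (hα z), rdiv_eq_two_mul_re_hdiv ((hZ z).const_smul c),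
    hdiv_const_smul c (hZ z), sum_mul_pd, Pi.smul_apply, map_smul]
  have hn : (Complex.normSq (α z) : ℂ) = starRingEnd ℂ (α z) * α z :=
    Complex.normSq_eq_conj_mul_self
  have key : 2 * (starRingEnd ℂ (α z) * c • fderiv ℂ α z (Z z)).re +
      Complex.normSq (α z) * (2 * (c * hdiv Z z).re) =
      2 * (c * (starRingEnd ℂ (α z) * (fderiv ℂ α z (Z z) + α z * hdiv Z z))).re := by
    rw [show c * (starRingEnd ℂ (α z) * (fderiv ℂ α z (Z z) + α z * hdiv Z z)) =
      starRingEnd ℂ (α z) * c • fderiv ℂ α z (Z z) +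
        (Complex.normSq (α z) : ℂ) * (c * hdiv Z z) by rw [hn, smul_eq_mul]; ring,
      Complex.add_re, Complex.re_ofReal_mul]
    ring
  rw [key]
  simp

/-- `∂/∂x - i ∂/∂y` of `|f|²` is `2 f̄ ∂f/∂z` for holomorphic `f`. -/
theorem px_sub_I_mul_py_normSq {f : (Fin n → ℂ) → ℂ} {z : Fin n → ℂ}
    (hf : DifferentiableAt ℂ f z) (i : Fin n) :
    (px (fun w => Complex.normSq (f w)) i z : ℂ) -
        Complex.I * (py (fun w => Complex.normSq (f w)) i z : ℂ) =
      2 * (starRingEnd ℂ (f z) * pd f i z) := by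
  have hI : fderiv ℂ f z (Pi.single i Complex.I) = Complex.I * pd f i z := by
    rw [pd, ← smul_eq_mul, ← map_smul, ← Pi.single_smul]
    simp
  rw [px, py, fderiv_normSq_comp hf, fderiv_normSq_comp hf, hI, ← pd]
  apply Complex.ext <;> simp
  ring

/-- For a holomorphic Poisson structure P on ℂⁿ (antisymmetric entire matrix
satisfying the Jacobi identity) and nowhere-vanishing entire f, α: α is a holomorphic last
multiplier for the Hamiltonian field Z_{log f} = (1/f)·Z_f iff |α|² is a real last multiplier
for both real Hamiltonian fields (1/|f|²)·Z^ℝ_{|f|²} and (1/|f|²)·Z^𝕀_{|f|²} of the real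
Poisson structures P_ℝ, P_𝕀 (built blockwise from (1/4)Re P^{ij}, (1/4)Im P^{ij} as in the
statement, real coordinates z^k = x^k + i x^{n+k}). -/
theorem last_multiplier_hamiltonian_iff_real_poisson
    (P : (Fin n → ℂ) → Matrix (Fin n) (Fin n) ℂ)
    (hP : ∀ i j z, AnalyticAt ℂ (fun w => P w i j) z)
    (hPanti : ∀ z i j, P z i j = -P z j i)
    (hJacobi : ∀ z i j k,
        (∑ l, (P z l i * pd (fun w => P w j k) l z +
               P z l j * pd (fun w => P w k i) l z +
               P z l k * pd (fun w => P w i j) l z)) = 0)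
    (f α : (Fin n → ℂ) → ℂ)
    (hf : ∀ z, AnalyticAt ℂ f z) (hf0 : ∀ z, f z ≠ 0)
    (hα : ∀ z, AnalyticAt ℂ α z) (hα0 : ∀ z, α z ≠ 0) :
    IsHLM (fun z j => (f z)⁻¹ * ∑ i, P z i j * pd f i z) α ↔
      (IsRLM
        (fun z j => ((Complex.normSq (f z) : ℂ))⁻¹ *
          (Complex.ofReal (∑ i,
              ((1 / 4) * (P z i j).re * px (fun w => Complex.normSq (f w)) i z -
               (1 / 4) * (P z j i).im * py (fun w => Complex.normSq (f w)) i z)) +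
           Complex.I * Complex.ofReal (∑ i,
              ((1 / 4) * (P z i j).im * px (fun w => Complex.normSq (f w)) i z -
               (1 / 4) * (P z i j).re * py (fun w => Complex.normSq (f w)) i z))))
        (fun z => Complex.normSq (α z)) ∧
       IsRLM
        (fun z j => ((Complex.normSq (f z) : ℂ))⁻¹ *
          (Complex.ofReal (∑ i,
              ((1 / 4) * (P z i j).im * px (fun w => Complex.normSq (f w)) i z +
               (1 / 4) * (P z j i).re * py (fun w => Complex.normSq (f w)) i z)) +
           Complex.I * Complex.ofReal (∑ i,
              (-((1 / 4) * (P z i j).re * px (fun w => Complex.normSq (f w)) i z) -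
               (1 / 4) * (P z i j).im * py (fun w => Complex.normSq (f w)) i z))))
        (fun z => Complex.normSq (α z))) := by
  have hfd : Differentiable ℂ f := fun z => (hf z).differentiableAt
  have hαd : Differentiable ℂ α := fun z => (hα z).differentiableAt
  set Z : (Fin n → ℂ) → (Fin n → ℂ) := fun z j => (f z)⁻¹ * ∑ i, P z i j * pd f i z with hZdef
  have hZ : Differentiable ℂ Z := by
    intro z
    refine differentiableAt_pi.2 fun j => ?_
    refine ((hfd z).inv (hf0 z)).mul (DifferentiableAt.fun_sum fun i _ => ?_)
    exact (hP i j z).differentiableAt.mul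
      ((hf z).fderiv.differentiableAt.clm_apply (differentiableAt_const _))
  have hW (c : ℂ) (z : Fin n → ℂ) (j : Fin n) :
      (Complex.normSq (f z) : ℂ)⁻¹ * (c * ∑ i, P z i j *
        ((px (fun w => Complex.normSq (f w)) i z : ℂ) -
          Complex.I * (py (fun w => Complex.normSq (f w)) i z : ℂ))) = ((2 * c) • Z) z j := by
    have hc : starRingEnd ℂ (f z) ≠ 0 := (map_ne_zero _).2 (hf0 z)
    simp only [px_sub_I_mul_py_normSq (hfd z), Complex.normSq_eq_conj_mul_self, hZdef,
      Pi.smul_apply, smul_eq_mul, Finset.mul_sum]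
    refine Finset.sum_congr rfl fun i _ => ?_
    have := hf0 z
    field_simp
  have hR := isRLM_const_smul_normSq_iff (2 * (1 / 4)) hZ hαd
  have hI := isRLM_const_smul_normSq_iff (2 * (-Complex.I / 4)) hZ hαd
  have eR : (2 * (1 / 4) : ℂ) • Z = _ := funext fun z => funext fun j => (hW _ z j).symm
  have eI : (2 * (-Complex.I / 4) : ℂ) • Z = _ := funext fun z => funext fun j => (hW _ z j).symm
  rw [eR] at hR
  rw [eI] at hI
  have main : IsHLM Z α ↔ (∀ z, ((2 * (1 / 4) : ℂ) * (starRingEnd ℂ (α z) *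
        ((∑ k, Z z k * pd α k z) + α z * hdiv Z z))).re = 0) ∧
      ∀ z, ((2 * (-Complex.I / 4) : ℂ) * (starRingEnd ℂ (α z) *
        ((∑ k, Z z k * pd α k z) + α z * hdiv Z z))).re = 0 := by
    rw [← forall_and]
    refine forall_congr' fun z => ?_
    have hc : starRingEnd ℂ (α z) ≠ 0 := (map_ne_zero _).2 (hα0 z)
    rw [← mul_right_inj' hc, mul_zero]
    generalize starRingEnd ℂ (α z) * ((∑ k, Z z k * pd α k z) + α z * hdiv Z z) = E
    rw [Complex.ext_iff]
    norm_num
  rw [main, ← hR, ← hI]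
  refine iff_of_eq (congrArg₂ And ?_ ?_) <;>
  · refine congrArg (fun X => IsRLM X _) (funext fun z => funext fun j => ?_)
    congr 1
    push_cast
    rw [Finset.mul_sum, Finset.mul_sum, ← Finset.sum_add_distrib]
    refine Finset.sum_congr rfl fun i _ => ?_
    rw [hPanti z j i]
    apply Complex.ext <;> simp <;> ring
end

section
/- Let P = (P^{ij}) be an antisymmetric n×n matrix of entire functions on ℂⁿ, and define the real antisymmetric 2n×2n matrices P_ℝ and P_𝕀 by P_ℝ^{ij} = (1/4)Re P^{ij}, P_ℝ^{i,n+j} = (1/4)Im P^{ij}, P_ℝ^{n+i,j} = −(1/4)Im P^{ji}, P_ℝ^{n+i,n+j} = −(1/4)Re P^{ij}, and P_𝕀^{ij} = (1/4)Im P^{ij}, P_𝕀^{i,n+j} = −(1/4)Re P^{ij}, P_𝕀^{n+i,j} = (1/4)Re P^{ji}, P_𝕀^{n+i,n+j} = −(1/4)Im P^{ij} (coordinates z^k = x^k + i·x^{n+k}). Let f be a nowhere-vanishing entire function on ℂⁿ. Then f is a holomorphic last multiplier for its own holomorphic Hamiltonian vector field Z_f (equivalently Σ_{i,j} (∂P^{ij}/∂z^j)(∂f/∂z^i)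 = 0 identically) if and only if |f|² is a real last multiplier (with respect to Lebesgue volume) for BOTH real Hamiltonian vector fields Z^ℝ_{|f|²} = (Σ_a P_ℝ^{ab} ∂|f|²/∂x^a)_b and Z^𝕀_{|f|²} = (Σ_a P_𝕀^{ab} ∂|f|²/∂x^a)_b. -/
open scoped BigOperators

variable {n : ℕ}

open ComplexConjugate

/-- The real trace of an endomorphism of `ℂⁿ`, computed in the basis `e_j, i e_j`. -/
theorem trace_real_pi_complex (L : (Fin n → ℂ) →ₗ[ℝ] (Fin n → ℂ)) :
    LinearMap.trace ℝ (Fin n → ℂ) L =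
      ∑ j, ((L (Pi.single j 1) j).re + (L (Pi.single j Complex.I) j).im) := by
  rw [LinearMap.trace_eq_matrix_trace ℝ (Pi.basis fun _ : Fin n => Complex.basisOneI),
    Matrix.trace, Fintype.sum_sigma]
  refine Finset.sum_congr rfl fun j _ => ?_
  simp [Fin.sum_univ_two, LinearMap.toMatrix_apply, Pi.basis_apply, Pi.basis_repr]

/-- The real derivative of `|f|²` is `v ↦ 2 Re (conj f · Df v)`. -/
theorem fderiv_normSq_apply {f : (Fin n → ℂ) → ℂ} {z : Fin n → ℂ}
    (hf : DifferentiableAt ℂ f z) (v : Fin n → ℂ) :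
    fderiv ℝ (fun w => Complex.normSq (f w)) z v = 2 * (conj (f z) * fderiv ℂ f z v).re := by
  have h := hf.hasFDerivAt.restrictScalars ℝ
  have hre := Complex.reCLM.hasFDerivAt.comp z h
  have him := Complex.imCLM.hasFDerivAt.comp z h
  have hu : HasFDerivAt (fun w => Complex.normSq (f w)) _ z := (hre.mul hre).add (him.mul him)
  rw [hu.fderiv]
  simp
  ring

theorem fderiv_apply_eq_sum_pd (f : (Fin n → ℂ) → ℂ) (z v : Fin n → ℂ) :
    fderiv ℂ f z v = ∑ k, v k * pd f k z := by
  conv_lhs => rw [← Finset.univ_sum_single v, map_sum]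
  refine Finset.sum_congr rfl fun k _ => ?_
  rw [pd, ← smul_eq_mul, ← map_smul, ← Pi.single_smul, smul_eq_mul, mul_one]

/-- The antiholomorphic factor `conj f` does not contribute to the real divergence. -/
theorem rdiv_conj_mul {f : (Fin n → ℂ) → ℂ} {Z : (Fin n → ℂ) → Fin n → ℂ} {z : Fin n → ℂ}
    (hf : DifferentiableAt ℂ f z) (hZ : ∀ j, DifferentiableAt ℂ (fun w => Z w j) z) (c : ℂ) :
    rdiv (fun w j => c * (conj (f w) * Z w j)) z = 2 * (c * (conj (f z) * hdiv Z z)).re := by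
  have hconj := Complex.conjCLE.toContinuousLinearMap.hasFDerivAt.comp z
    (hf.hasFDerivAt.restrictScalars ℝ)
  have hX := hasFDerivAt_pi.2 fun j =>
    (hconj.mul ((hZ j).hasFDerivAt.restrictScalars ℝ)).const_mul c
  have hX' : HasFDerivAt (fun w j => c * (conj (f w) * Z w j)) _ z := hX
  have hI (g : (Fin n → ℂ) → ℂ) (j : Fin n) :
      fderiv ℂ g z (Pi.single j Complex.I) = Complex.I * fderiv ℂ g z (Pi.single j 1) := by
    rw [← smul_eq_mul, ← map_smul, ← Pi.single_smul, smul_eq_mul, mul_one]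
  rw [rdiv, hX'.fderiv, trace_real_pi_complex, hdiv, Finset.mul_sum, Finset.mul_sum,
    Complex.re_sum, Finset.mul_sum]
  refine Finset.sum_congr rfl fun j _ => ?_
  simp [hI, pd]
  ring

theorem isRLM_conj_mul_iff {f : (Fin n → ℂ) → ℂ} {Z : (Fin n → ℂ) → Fin n → ℂ}
    (hf : Differentiable ℂ f) (hZ : ∀ j, Differentiable ℂ fun w => Z w j) (c : ℂ) :
    IsRLM (fun w j => c * (conj (f w) * Z w j)) (fun w => Complex.normSq (f w)) ↔
      ∀ z, (c * (conj (f z) ^ 2 * ((∑ k, Z z k * pd f k z) + f z * hdiv Z z))).re = 0 := by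
  refine forall_congr' fun z => ?_
  have hsum : fderiv ℂ f z (fun j => c * (conj (f z) * Z z j)) =
      c * (conj (f z) * ∑ k, Z z k * pd f k z) := by
    simp only [fderiv_apply_eq_sum_pd, Finset.mul_sum, mul_assoc]
  rw [fderiv_normSq_apply (hf z), rdiv_conj_mul (hf z) (fun j => hZ j z), hsum]
  generalize (∑ k, Z z k * pd f k z) = s
  generalize hdiv Z z = d
  have key : 2 * (conj (f z) * (c * (conj (f z) * s))).re +
      Complex.normSq (f z) * (2 * (c * (conj (f z) * d)).re) =
      2 * (c * (conj (f z) ^ 2 * (s + f z * d))).re := by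
    rw [mul_left_comm (Complex.normSq _), ← Complex.re_ofReal_mul (Complex.normSq _),
      Complex.normSq_eq_conj_mul_self, ← mul_add, ← Complex.add_re]
    ring_nf
  rw [key]
  simp

/-- For an antisymmetric matrix P of entire functions on ℂⁿ and a
nowhere-vanishing entire f: f is a holomorphic last multiplier for its own Hamiltonian vector
field Z_f iff |f|² is a real last multiplier for both real Hamiltonian vector fields
Z^ℝ_{|f|²} and Z^𝕀_{|f|²} of the real Poisson structures P_ℝ, P_𝕀 (built blockwise from
(1/4)Re P^{ij}, (1/4)Im P^{ij}, real coordinates z^k = x^k + i x^{n+k}). -/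
theorem self_last_multiplier_iff_real_poisson
    (P : (Fin n → ℂ) → Matrix (Fin n) (Fin n) ℂ)
    (hP : ∀ i j z, AnalyticAt ℂ (fun w => P w i j) z)
    (hPanti : ∀ z i j, P z i j = -P z j i)
    (f : (Fin n → ℂ) → ℂ)
    (hf : ∀ z, AnalyticAt ℂ f z) (hf0 : ∀ z, f z ≠ 0) :
    IsHLM (fun z j => ∑ i, P z i j * pd f i z) f ↔
      (IsRLM
        (fun z j =>
          Complex.ofReal (∑ i,
              ((1 / 4) * (P z i j).re * px (fun w => Complex.normSq (f w)) i z -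
               (1 / 4) * (P z j i).im * py (fun w => Complex.normSq (f w)) i z)) +
           Complex.I * Complex.ofReal (∑ i,
              ((1 / 4) * (P z i j).im * px (fun w => Complex.normSq (f w)) i z -
               (1 / 4) * (P z i j).re * py (fun w => Complex.normSq (f w)) i z)))
        (fun z => Complex.normSq (f z)) ∧
       IsRLM
        (fun z j =>
          Complex.ofReal (∑ i,
              ((1 / 4) * (P z i j).im * px (fun w => Complex.normSq (f w)) i z +
               (1 / 4) * (P z j i).re * py (fun w => Complex.normSq (f w)) i z)) +
           Complex.I * Complex.ofReal (∑ i,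
              (-((1 / 4) * (P z i j).re * px (fun w => Complex.normSq (f w)) i z) -
               (1 / 4) * (P z i j).im * py (fun w => Complex.normSq (f w)) i z)))
        (fun z => Complex.normSq (f z))) := by
  have hfd : Differentiable ℂ f := fun z => (hf z).differentiableAt
  have hpd (i : Fin n) : Differentiable ℂ (pd f i) := fun z =>
    (hf z).fderiv.differentiableAt.clm_apply (differentiableAt_const _)
  have hZ (j : Fin n) : Differentiable ℂ fun z => ∑ i, P z i j * pd f i z :=
    Differentiable.fun_sum fun i _ =>
      Differentiable.fun_mul (fun z => (hP i j z).differentiableAt) (hpd i)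
  have hpx (i : Fin n) (z : Fin n → ℂ) :
      px (fun w => Complex.normSq (f w)) i z = 2 * (conj (f z) * pd f i z).re :=
    fderiv_normSq_apply (hfd z) _
  have hpy (i : Fin n) (z : Fin n → ℂ) :
      py (fun w => Complex.normSq (f w)) i z = -2 * (conj (f z) * pd f i z).im := by
    rw [py, fderiv_normSq_apply (hfd z), fderiv_apply_eq_sum_pd,
      Finset.sum_eq_single i (by simp +contextual) (by simp), Pi.single_eq_same]
    simp
    ring
  have hre (z : Fin n → ℂ) (i j : Fin n) : (P z j i).re = -(P z i j).re := by
    rw [hPanti z j i, Complex.neg_re]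
  have him (z : Fin n → ℂ) (i j : Fin n) : (P z j i).im = -(P z i j).im := by
    rw [hPanti z j i, Complex.neg_im]
  have hR : (fun (z : Fin n → ℂ) (j : Fin n) =>
      Complex.ofReal (∑ i,
          ((1 / 4) * (P z i j).re * px (fun w => Complex.normSq (f w)) i z -
           (1 / 4) * (P z j i).im * py (fun w => Complex.normSq (f w)) i z)) +
       Complex.I * Complex.ofReal (∑ i,
          ((1 / 4) * (P z i j).im * px (fun w => Complex.normSq (f w)) i z -
           (1 / 4) * (P z i j).re * py (fun w => Complex.normSq (f w)) i z))) =
      fun z j => ((1 / 2 : ℝ) : ℂ) * (conj (f z) * ∑ i, P z i j * pd f i z) := by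
    funext z j
    simp only [Complex.ofReal_sum, Finset.mul_sum, ← Finset.sum_add_distrib]
    refine Finset.sum_congr rfl fun i _ => ?_
    rw [hpx, hpy, him z i j]
    apply Complex.ext <;> simp <;> ring
  have hI : (fun (z : Fin n → ℂ) (j : Fin n) =>
      Complex.ofReal (∑ i,
          ((1 / 4) * (P z i j).im * px (fun w => Complex.normSq (f w)) i z +
           (1 / 4) * (P z j i).re * py (fun w => Complex.normSq (f w)) i z)) +
       Complex.I * Complex.ofReal (∑ i,
          (-((1 / 4) * (P z i j).re * px (fun w => Complex.normSq (f w)) i z) -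
           (1 / 4) * (P z i j).im * py (fun w => Complex.normSq (f w)) i z))) =
      fun z j => (((-1 / 2 : ℝ) : ℂ) * Complex.I) *
        (conj (f z) * ∑ i, P z i j * pd f i z) := by
    funext z j
    simp only [Complex.ofReal_sum, Finset.mul_sum, ← Finset.sum_add_distrib]
    refine Finset.sum_congr rfl fun i _ => ?_
    rw [hpx, hpy, hre z i j]
    apply Complex.ext <;> simp <;> ring
  rw [hR, hI, isRLM_conj_mul_iff hfd hZ, isRLM_conj_mul_iff hfd hZ, ← forall_and]
  refine forall_congr' fun z => ?_
  have hc : conj (f z) ^ 2 ≠ 0 := pow_ne_zero 2 ((map_ne_zero _).2 (hf0 z))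
  rw [mul_assoc, Complex.re_ofReal_mul, Complex.re_ofReal_mul, Complex.I_mul_re,
    ← mul_eq_zero_iff_left hc]
  generalize conj (f z) ^ 2 * _ = t
  rw [Complex.ext_iff]
  norm_num
end

section
/- Let P = (P^{ij}) be an antisymmetric 4×4 matrix of entire functions on ℂ⁴ which is an exact holomorphic Poisson structure (it satisfies the Jacobi identity Σ_{l=1}^4 (P^{li} ∂P^{jk}/∂z^l + P^{lj} ∂P^{ki}/∂z^l + P^{lk} ∂P^{ij}/∂z^l) = 0 for all i,j,k and Σ_{j=1}^4 ∂P^{ij}/∂z^j = 0 for all i), and suppose P(z₀) = 0 at some point z₀ ∈ ℂ⁴. Then: (i) at every point z ∈ ℂ⁴ the matrix P(z) has rank at most 2; (ii) for every entire function α on ℂ⁴, the bivector αP also satisfies the Jacobi identity, i.e. αP is again a holomorphic Poisson structure. -/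
open scoped BigOperators

variable {n : ℕ}

/-- The Pfaffian of an antisymmetric `4 × 4` matrix, in terms of its entries above the diagonal. -/
def pfaffianFour (M : Matrix (Fin 4) (Fin 4) ℂ) : ℂ :=
  M 0 1 * M 2 3 - M 0 2 * M 1 3 + M 0 3 * M 1 2

theorem diag_eq_zero_of_antisymm {ι : Type*} {M : Matrix ι ι ℂ}
    (hM : ∀ i j, M i j = -M j i) (i : ι) : M i i = 0 :=
  self_eq_neg.mp (hM i i)

/-- The Plücker relations for an antisymmetric matrix with vanishing Pfaffian. -/
theorem plucker_of_pfaffianFour_eq_zero {M : Matrix (Fin 4) (Fin 4) ℂ}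
    (hM : ∀ i j, M i j = -M j i) (hpf : pfaffianFour M = 0) (l i j k : Fin 4) :
    M l i * M j k + M l j * M k i + M l k * M i j = 0 := by
  have hd := diag_eq_zero_of_antisymm hM
  have h10 := hM 1 0
  have h20 := hM 2 0
  have h30 := hM 3 0
  have h21 := hM 2 1
  have h31 := hM 3 1
  have h32 := hM 3 2
  unfold pfaffianFour at hpf
  fin_cases l <;> fin_cases i <;> fin_cases j <;> fin_cases k <;>
    simp only [Fin.zero_eta, Fin.mk_one, Fin.reduceFinMk, hd, h10, h20, h30, h21, h31, h32] <;>
    first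
      | ring1
      | linear_combination hpf
      | linear_combination -hpf

theorem rank_le_two_of_pfaffianFour_eq_zero {M : Matrix (Fin 4) (Fin 4) ℂ}
    (hM : ∀ i j, M i j = -M j i) (hpf : pfaffianFour M = 0) : M.rank ≤ 2 := by
  by_cases h0 : M = 0
  · simp [h0]
  obtain ⟨a, b, hab⟩ : ∃ a b, M a b ≠ 0 := by
    by_contra! h
    exact h0 (Matrix.ext h)
  let A : Matrix (Fin 4) (Fin 2) ℂ := Matrix.of fun i => ![M a i / M a b, -(M b i / M a b)]
  let B : Matrix (Fin 2) (Fin 4) ℂ := Matrix.of ![M b, M a]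
  have hAB : M = A * B := by
    ext i j
    have h := plucker_of_pfaffianFour_eq_zero hM hpf a b i j
    rw [hM j b] at h
    simp only [A, B, Matrix.mul_apply, Fin.sum_univ_two, Matrix.of_apply, Matrix.cons_val_zero,
      Matrix.cons_val_one]
    field_simp
    linear_combination h
  calc M.rank = (A * B).rank := by rw [← hAB]
    _ ≤ A.rank := Matrix.rank_mul_le_left A B
    _ ≤ 2 := by simpa using A.rank_le_card_width

theorem pd_mul {n : ℕ} {f g : (Fin n → ℂ) → ℂ} {z : Fin n → ℂ} (hf : DifferentiableAt ℂ f z)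
    (hg : DifferentiableAt ℂ g z) (i : Fin n) :
    pd (fun w => f w * g w) i z = f z * pd g i z + g z * pd f i z := by
  simp [pd, fderiv_fun_mul hf hg]

theorem pd_pfaffianFour {P : (Fin 4 → ℂ) → Matrix (Fin 4) (Fin 4) ℂ} {z : Fin 4 → ℂ}
    (hP : ∀ i j, DifferentiableAt ℂ (fun w => P w i j) z) (l : Fin 4) :
    pd (fun w => pfaffianFour (P w)) l z =
      P z 0 1 * pd (fun w => P w 2 3) l z + P z 2 3 * pd (fun w => P w 0 1) l z -
      (P z 0 2 * pd (fun w => P w 1 3) l z + P z 1 3 * pd (fun w => P w 0 2) l z) +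
      (P z 0 3 * pd (fun w => P w 1 2) l z + P z 1 2 * pd (fun w => P w 0 3) l z) := by
  rw [← pd_mul (hP 0 1) (hP 2 3), ← pd_mul (hP 0 2) (hP 1 3), ← pd_mul (hP 0 3) (hP 1 2)]
  have h1 := (hP 0 1).fun_mul (hP 2 3)
  have h2 := (hP 0 2).fun_mul (hP 1 3)
  have h3 := (hP 0 3).fun_mul (hP 1 2)
  simp only [pd, pfaffianFour]
  rw [fderiv_fun_add (h1.fun_sub h2) h3, fderiv_fun_sub h1 h2]
  rfl

/-- The Pfaffian of an exact Poisson structure on `ℂ⁴` has vanishing partial derivatives. -/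
theorem pd_pfaffianFour_eq_zero {P : (Fin 4 → ℂ) → Matrix (Fin 4) (Fin 4) ℂ} {z : Fin 4 → ℂ}
    (hP : ∀ i j, DifferentiableAt ℂ (fun w => P w i j) z)
    (hPanti : ∀ z i j, P z i j = -P z j i)
    (hJacobi : ∀ i j k : Fin 4,
        (∑ l, (P z l i * pd (fun w => P w j k) l z +
               P z l j * pd (fun w => P w k i) l z +
               P z l k * pd (fun w => P w i j) l z)) = 0)
    (hexact : ∀ i : Fin 4, (∑ j, pd (fun w => P w i j) j z) = 0) (l : Fin 4) :
    pd (fun w => pfaffianFour (P w)) l z = 0 := by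
  have hdP := diag_eq_zero_of_antisymm (hPanti z)
  have hD : ∀ i j l, pd (fun w => P w i j) l z = -pd (fun w => P w j i) l z := by
    intro i j l
    simp only [pd, fun w => hPanti w i j, fderiv_fun_neg, neg_apply]
  have hdD : ∀ i l, pd (fun w => P w i i) l z = 0 := fun i l => self_eq_neg.mp (hD i i l)
  rw [pd_pfaffianFour hP]
  have e0 := hexact 0
  have e1 := hexact 1
  have e2 := hexact 2
  have e3 := hexact 3
  have j0 := hJacobi 1 2 3
  have j1 := hJacobi 0 2 3
  have j2 := hJacobi 0 1 3
  have j3 := hJacobi 0 1 2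
  simp only [Fin.sum_univ_four, hdP, hdD, hPanti z 1 0, hPanti z 2 0, hPanti z 3 0, hPanti z 2 1,
    hPanti z 3 1, hPanti z 3 2, hD 1 0, hD 2 0, hD 3 0, hD 2 1, hD 3 1, hD 3 2]
    at e0 e1 e2 e3 j0 j1 j2 j3
  fin_cases l <;> simp only [Fin.zero_eta, Fin.mk_one, Fin.reduceFinMk]
  · linear_combination j0 - P z 2 3 * e1 + P z 1 3 * e2 - P z 1 2 * e3
  · linear_combination -j1 + P z 2 3 * e0 - P z 0 3 * e2 + P z 0 2 * e3
  · linear_combination j2 - P z 1 3 * e0 + P z 0 3 * e1 - P z 0 1 * e3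
  · linear_combination -j3 + P z 1 2 * e0 - P z 0 2 * e1 + P z 0 1 * e2

/-- An entire function all of whose partial derivatives vanish is constant. -/
theorem eq_of_pd_eq_zero {n : ℕ} {f : (Fin n → ℂ) → ℂ} (hf : Differentiable ℂ f)
    (h : ∀ z i, pd f i z = 0) (z w : Fin n → ℂ) : f z = f w := by
  refine is_const_of_fderiv_eq_zero (𝕜 := ℂ) hf (fun z => ?_) z w
  refine ContinuousLinearMap.coe_injective (LinearMap.pi_ext' fun i => ?_)
  ext
  simpa [pd] using h z i

/-- If P is an exact holomorphic Poisson structure on ℂ⁴ (Jacobi identity and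
Σ_j ∂P^{ij}/∂z^j = 0) vanishing at some point z₀, then (i) rank P(z) ≤ 2 at every point, and
(ii) for every entire α, the bivector αP again satisfies the Jacobi identity. -/
theorem exact_poisson_rank_and_rescaling
    (P : (Fin 4 → ℂ) → Matrix (Fin 4) (Fin 4) ℂ)
    (hP : ∀ i j z, AnalyticAt ℂ (fun w => P w i j) z)
    (hPanti : ∀ z i j, P z i j = -P z j i)
    (hJacobi : ∀ z, ∀ i j k : Fin 4,
        (∑ l, (P z l i * pd (fun w => P w j k) l z +
               P z l j * pd (fun w => P w k i) l z +
               P z l k * pd (fun w => P w i j) l z)) = 0)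
    (hexact : ∀ i : Fin 4, ∀ z, (∑ j, pd (fun w => P w i j) j z) = 0)
    (z₀ : Fin 4 → ℂ) (hz₀ : P z₀ = 0) :
    (∀ z, (P z).rank ≤ 2) ∧
    (∀ α : (Fin 4 → ℂ) → ℂ, (∀ z, AnalyticAt ℂ α z) →
      ∀ z, ∀ i j k : Fin 4,
        (∑ l, ((α z * P z l i) * pd (fun w => α w * P w j k) l z +
               (α z * P z l j) * pd (fun w => α w * P w k i) l z +
               (α z * P z l k) * pd (fun w => α w * P w i j) l z)) = 0) := by
  have hdiff : ∀ z i j, DifferentiableAt ℂ (fun w => P w i j) z :=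
    fun z i j => (hP i j z).differentiableAt
  have hpf : ∀ z, pfaffianFour (P z) = 0 := by
    intro z
    have hf : Differentiable ℂ fun w => pfaffianFour (P w) := fun w =>
      (((hdiff w 0 1).fun_mul (hdiff w 2 3)).fun_sub
        ((hdiff w 0 2).fun_mul (hdiff w 1 3))).fun_add ((hdiff w 0 3).fun_mul (hdiff w 1 2))
    have hconst := eq_of_pd_eq_zero hf (fun w l =>
      pd_pfaffianFour_eq_zero (hdiff w) hPanti (hJacobi w) (fun i => hexact i w) l) z z₀
    simpa [hz₀, pfaffianFour] using hconst
  refine ⟨fun z => rank_le_two_of_pfaffianFour_eq_zero (hPanti z) (hpf z), ?_⟩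
  intro α hα z i j k
  have hαz := (hα z).differentiableAt
  have hsum : ∑ l, (α z * pd α l z *
      (P z l i * P z j k + P z l j * P z k i + P z l k * P z i j)) = 0 :=
    Finset.sum_eq_zero fun l _ => by
      rw [plucker_of_pfaffianFour_eq_zero (hPanti z) (hpf z), mul_zero]
  have hJ := congrArg (α z ^ 2 * ·) (hJacobi z i j k)
  simp only [Finset.mul_sum, mul_zero] at hJ
  refine Eq.trans ?_ (Finset.sum_add_distrib.trans ((congrArg₂ (· + ·) hJ hsum).trans (add_zero 0)))
  refine Finset.sum_congr rfl fun l _ => ?_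
  rw [pd_mul hαz (hdiff z j k), pd_mul hαz (hdiff z k i), pd_mul hαz (hdiff z i j)]
  ring
end
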